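/- arXiv:2504.01003 — 8 statements merged into one kernel-verified Lean document; each statement's English description precedes it below -/
import Mathlib

section
/- For every prime p, the ratio of the number of flat transfer systems for the cyclic group C_{p^n} to the total number of transfer systems for C_{p^n} tends to 1/3 as n → ∞; equivalently, lim_{n→∞} (∑_{k=0}^{n} Catalan(k)) / Catalan(n+1) = 1/3. -/
/-- A transfer system for a finite group `G`. -/
def IsTransferSystem {G : Type*} [Group G] (T : Set (Subgroup G × Subgroup G)) : Prop :=
  (∀ p ∈ T, p.1 ≤ p.2) ∧
  (∀ H : Subgroup G, (H, H) ∈ T) ∧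
  (∀ H K L : Subgroup G, (H, K) ∈ T → (K, L) ∈ T → (H, L) ∈ T) ∧
  (∀ H K : Subgroup G, (H, K) ∈ T → ∀ g : G,
    (Subgroup.map (MulAut.conj g).toMonoidHom H, Subgroup.map (MulAut.conj g).toMonoidHom K) ∈ T) ∧
  (∀ H K L : Subgroup G, (H, K) ∈ T → L ≤ K → (H ⊓ L, L) ∈ T)

/-- `F` is the minimal fibrant subgroup of the transfer system `T`. -/
def IsMinimalFibrant {G : Type*} [Group G] (T : Set (Subgroup G × Subgroup G))
    (F : Subgroup G) : Prop :=
  (F, ⊤) ∈ T ∧ ∀ H : Subgroup G, (H, ⊤) ∈ T → F ≤ H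

/-- A transfer system is flat if there is no pair `(H, K) ∈ T` with `H < K ≤ F`,
where `F` is the minimal fibrant subgroup. -/
def IsFlat {G : Type*} [Group G] (T : Set (Subgroup G × Subgroup G)) : Prop :=
  ∀ F : Subgroup G, IsMinimalFibrant T F →
    ¬∃ H K : Subgroup G, (H, K) ∈ T ∧ H < K ∧ K ≤ F

/-- The inflationary functions `f` on `{0, …, N - 1}`, extended by the identity, such that
`i ≤ j ≤ f i` implies `f j ≤ f i`. They encode the transfer systems on a chain with `N` elements:
`f i` is the largest `j` such that `i` transfers to `j`. -/
def chainClosures (N : ℕ) : Set (ℕ → ℕ) :=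
  {f | (∀ i, i ≤ f i) ∧ (∀ i < N, f i < N) ∧ (∀ i, N ≤ i → f i = i) ∧
    ∀ i j, i ≤ j → j ≤ f i → f j ≤ f i}

/-- The function sending `k` to `N`, given by `g` below `k` and by a shift of `h` above `k`. -/
def glue (k N : ℕ) (g h : ℕ → ℕ) (i : ℕ) : ℕ :=
  if i < k then g i else if i = k then N else h (i - (k + 1)) + (k + 1)

/-- The elements of `chainClosures (N + 1)` encoding flat transfer systems. -/
def flatChainClosures (N : ℕ) : Set (ℕ → ℕ) :=
  {f | f ∈ chainClosures (N + 1) ∧ ∃ k, f k = N ∧ ∀ i < k, f i = i}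

lemma glue_mem {k N : ℕ} (hk : k ≤ N) {g h : ℕ → ℕ} (hg : g ∈ chainClosures k)
    (hh : h ∈ chainClosures (N - k)) : glue k N g h ∈ chainClosures (N + 1) := by
  obtain ⟨g1, g2, g3, g4⟩ := hg
  obtain ⟨h1, h2, h3, h4⟩ := hh
  refine ⟨fun i => ?_, fun i hi => ?_, fun i hi => ?_, fun i j hij hj => ?_⟩
  · have := g1 i
    have := h1 (i - (k + 1))
    unfold glue; split_ifs <;> omega
  · have := g2 i
    have := h2 (i - (k + 1))
    unfold glue; split_ifs <;> omega
  · have := h3 (i - (k + 1))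
    unfold glue; split_ifs <;> omega
  · have a1 := g2 i
    have a3 := g4 i j
    have a4 := h4 (i - (k + 1)) (j - (k + 1))
    have a5 := h2 (j - (k + 1))
    have a6 := h3 (j - (k + 1))
    unfold glue at hj ⊢; split_ifs at hj ⊢ <;> omega

lemma exists_eq_glue {k N : ℕ} {f : ℕ → ℕ} (hf : f ∈ chainClosures (N + 1)) (hk : f k = N)
    (hlt : ∀ i < k, f i < k) :
    ∃ g ∈ chainClosures k, ∃ h ∈ chainClosures (N - k), glue k N g h = f := by
  obtain ⟨f1, f2, f3, f4⟩ := hf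
  have hkN := f1 k
  refine ⟨fun i => if i < k then f i else i, ⟨fun i => ?_, fun i hi => ?_, fun i hi => ?_,
    fun i j hij hj => ?_⟩, fun i => f (i + (k + 1)) - (k + 1), ⟨fun i => ?_, fun i hi => ?_,
    fun i hi => ?_, fun i j hij hj => ?_⟩, funext fun i => ?_⟩
  · have := f1 i; dsimp only; split_ifs <;> omega
  · have := hlt i hi; dsimp only; split_ifs; omega
  · dsimp only; split_ifs <;> omega
  · have := f4 i j; have := hlt i; dsimp only at hj ⊢; split_ifs at hj ⊢ <;> omega
  · have := f1 (i + (k + 1)); dsimp only; omega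
  · have := f2 (i + (k + 1)); dsimp only; omega
  · have := f3 (i + (k + 1)); dsimp only; omega
  · have := f4 (i + (k + 1)) (j + (k + 1)); have := f1 (i + (k + 1)); dsimp only at hj ⊢; omega
  · unfold glue
    split_ifs with h1 h2
    · exact if_pos h1
    · rw [h2, hk]
    · have := f1 i
      have e : i - (k + 1) + (k + 1) = i := by omega
      dsimp only; rw [e]; omega

lemma glue_injOn (k N : ℕ) :
    Set.InjOn (fun q : (ℕ → ℕ) × (ℕ → ℕ) => glue k N q.1 q.2)
      (chainClosures k ×ˢ chainClosures (N - k)) := by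
  rintro ⟨g, h⟩ ⟨hg, -⟩ ⟨g', h'⟩ ⟨hg', -⟩ e
  ext i
  · by_cases hi : i < k
    · simpa [glue, hi] using congrFun e i
    · exact (hg.2.2.1 i (by omega)).trans (hg'.2.2.1 i (by omega)).symm
  · have := congrFun e (i + (k + 1))
    simp only [glue] at this
    rw [if_neg (by omega), if_neg (by omega), if_neg (by omega), if_neg (by omega)] at this
    simpa using this

lemma exists_split {N : ℕ} {f : ℕ → ℕ} (hf : f ∈ chainClosures (N + 1)) :
    ∃ k ≤ N, f k = N ∧ ∀ i < k, f i < k := by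
  classical
  obtain ⟨f1, f2, f3, f4⟩ := hf
  have hex : ∃ k, f k = N := ⟨N, le_antisymm (by have := f2 N; omega) (f1 N)⟩
  refine ⟨Nat.find hex, by have := f1 (Nat.find hex); rwa [Nat.find_spec hex] at this,
    Nat.find_spec hex, fun i hi => ?_⟩
  by_contra hc
  have h1 := Nat.find_min hex hi
  have h2 := f4 i _ hi.le (not_lt.1 hc)
  rw [Nat.find_spec hex] at h2
  have := f1 (Nat.find hex)
  rw [Nat.find_spec hex] at this
  have := f2 i (by omega)
  omega

lemma id_mem_chainClosures (k : ℕ) : id ∈ chainClosures k :=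
  ⟨fun _ => le_rfl, fun _ hi => hi, fun _ _ => rfl, fun _ _ _ h => h⟩

lemma chainClosures_zero : chainClosures 0 = {id} := by
  ext f
  refine ⟨fun h => funext fun i => h.2.2.1 i (Nat.zero_le i), ?_⟩
  rintro rfl
  exact id_mem_chainClosures 0

lemma chainClosures_succ (N : ℕ) : chainClosures (N + 1) = ⋃ k ∈ Finset.range (N + 1),
    (fun q : (ℕ → ℕ) × (ℕ → ℕ) => glue k N q.1 q.2) ''
      (chainClosures k ×ˢ chainClosures (N - k)) := by
  ext f
  simp only [Set.mem_iUnion, Finset.mem_range, Set.mem_image, Set.mem_prod, Prod.exists]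
  constructor
  · intro hf
    obtain ⟨k, hk, h1, h2⟩ := exists_split hf
    obtain ⟨g, hg, h, hh, rfl⟩ := exists_eq_glue hf h1 h2
    exact ⟨k, by omega, g, h, ⟨hg, hh⟩, rfl⟩
  · rintro ⟨k, hk, g, h, ⟨hg, hh⟩, rfl⟩
    exact glue_mem (by omega) hg hh

lemma flatChainClosures_eq (N : ℕ) : flatChainClosures N = ⋃ k ∈ Finset.range (N + 1),
    (fun q : (ℕ → ℕ) × (ℕ → ℕ) => glue k N q.1 q.2) '' ({id} ×ˢ chainClosures (N - k)) := by
  ext f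
  simp only [Set.mem_iUnion, Finset.mem_range, Set.mem_image, Set.mem_prod, Prod.exists,
    Set.mem_singleton_iff]
  constructor
  · rintro ⟨hf, k, h1, h2⟩
    obtain ⟨g, hg, h, hh, rfl⟩ := exists_eq_glue hf h1 fun i hi => (h2 i hi).symm ▸ hi
    refine ⟨k, by have := hf.1 k; omega, id, h, ⟨rfl, hh⟩, ?_⟩
    congr 1
    ext i
    by_cases hi : i < k
    · simpa [glue, hi] using (h2 i hi).symm
    · exact (hg.2.2.1 i (by omega)).symm
  · rintro ⟨k, hk, g, h, ⟨rfl, hh⟩, rfl⟩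
    exact ⟨glue_mem (by omega) (id_mem_chainClosures k) hh, k, by simp [glue],
      fun i hi => by simp [glue, hi]⟩

lemma glue_images_disjoint (N : ℕ) :
    Set.PairwiseDisjoint (Finset.range (N + 1) : Set ℕ) fun k =>
      (fun q : (ℕ → ℕ) × (ℕ → ℕ) => glue k N q.1 q.2) ''
        (chainClosures k ×ˢ chainClosures (N - k)) := by
  have key : ∀ k k' g h g' h', k < k' → k' ≤ N → g' ∈ chainClosures k' →
      glue k N g h ≠ glue k' N g' h' := by
    intro k k' g h g' h' hlt hk' hg' e
    have := congrFun e k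
    have := hg'.2.1 k hlt
    simp only [glue, lt_irrefl, if_false, if_true, hlt] at *
    omega
  intro k hk k' hk' hne
  simp only [Finset.coe_range, Set.mem_Iio] at hk hk'
  rw [Function.onFun, Set.disjoint_left]
  rintro _ ⟨⟨g, h⟩, ⟨hg, -⟩, rfl⟩ ⟨⟨g', h'⟩, ⟨hg', -⟩, e⟩
  rcases lt_or_gt_of_ne hne with hlt | hlt
  · exact key _ _ _ _ _ _ hlt (by omega) hg' e.symm
  · exact key _ _ _ _ _ _ hlt (by omega) hg e

lemma ncard_biUnion_finset {ι α : Type*} (s : Finset ι) (A : ι → Set α)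
    (hA : ∀ i ∈ s, (A i).Finite) (hd : Set.PairwiseDisjoint (s : Set ι) A) :
    (⋃ i ∈ s, A i).ncard = ∑ i ∈ s, (A i).ncard := by
  rw [← finsum_mem_coe_finset, ← s.finite_toSet.ncard_biUnion hA hd]
  simp

lemma chainClosures_finite (N : ℕ) : (chainClosures N).Finite := by
  induction N using Nat.strong_induction_on with
  | _ N ih =>
    cases N with
    | zero => rw [chainClosures_zero]; exact Set.finite_singleton _
    | succ N =>
      rw [chainClosures_succ]
      refine (Finset.range (N + 1)).finite_toSet.biUnion fun k hk => ?_
      have := Finset.mem_range.1 hk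
      exact ((ih k (by omega)).prod (ih (N - k) (by omega))).image _

theorem ncard_chainClosures (N : ℕ) : (chainClosures N).ncard = catalan N := by
  induction N using Nat.strong_induction_on with
  | _ N ih =>
    cases N with
    | zero => rw [chainClosures_zero, Set.ncard_singleton, catalan_zero]
    | succ N =>
      rw [chainClosures_succ, ncard_biUnion_finset _ _ _ (glue_images_disjoint N), catalan_succ,
        Fin.sum_univ_eq_sum_range (fun i => catalan i * catalan (N - i))]
      · refine Finset.sum_congr rfl fun k hk => ?_
        have := Finset.mem_range.1 hk
        rw [(glue_injOn k N).ncard_image, Set.ncard_prod, ih k (by omega),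
          ih (N - k) (by omega)]
      · exact fun k _ => ((chainClosures_finite _).prod (chainClosures_finite _)).image _

theorem ncard_flatChainClosures (N : ℕ) :
    (flatChainClosures N).ncard = ∑ k ∈ Finset.range (N + 1), catalan k := by
  have hsub (k : ℕ) : ({id} : Set (ℕ → ℕ)) ×ˢ chainClosures (N - k) ⊆
      chainClosures k ×ˢ chainClosures (N - k) :=
    Set.prod_mono_left (Set.singleton_subset_iff.2 (id_mem_chainClosures k))
  rw [flatChainClosures_eq, ncard_biUnion_finset _ _ _
    ((glue_images_disjoint N).mono fun k => Set.image_mono (hsub k)), ← Finset.sum_range_reflect]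
  · refine Finset.sum_congr rfl fun k hk => ?_
    have := Finset.mem_range.1 hk
    rw [((glue_injOn _ N).mono (hsub _)).ncard_image, Set.ncard_prod,
      Set.ncard_singleton, one_mul, ncard_chainClosures]
    congr 1
    omega
  · exact fun k _ => ((Set.finite_singleton _).prod (chainClosures_finite _)).image _

lemma add_two_mul_catalan_succ (n : ℕ) :
    (n + 2) * catalan (n + 1) = 2 * (2 * n + 1) * catalan n := by
  have h1 := Nat.succ_mul_centralBinom_succ n
  rw [← succ_mul_catalan_eq_centralBinom, ← succ_mul_catalan_eq_centralBinom] at h1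
  refine Nat.eq_of_mul_eq_mul_left n.succ_pos ?_
  rw [Nat.succ_eq_add_one]
  linear_combination h1

lemma catalan_pos (n : ℕ) : 0 < catalan n := by
  refine Nat.pos_of_ne_zero fun h => (Nat.centralBinom_pos n).ne' ?_
  rw [← succ_mul_catalan_eq_centralBinom, h, mul_zero]

theorem tendsto_sum_catalan_div_catalan_succ : Filter.Tendsto (fun n : ℕ =>
      ((∑ k ∈ Finset.range (n + 1), catalan k : ℕ) : ℝ) / (catalan (n + 1) : ℝ))
      Filter.atTop (nhds (1 / 3)) := by
  set r : ℕ → ℝ := fun n =>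
    ((∑ k ∈ Finset.range (n + 1), catalan k : ℕ) : ℝ) / (catalan (n + 1) : ℝ) with hr
  have hrec (n : ℕ) : r (n + 1) = (r n + 1) * ((n + 3) / (2 * (2 * n + 3))) := by
    have h := congrArg (Nat.cast : ℕ → ℝ) (add_two_mul_catalan_succ (n + 1))
    push_cast at h
    have p1 : (0 : ℝ) < catalan (n + 1) := mod_cast catalan_pos _
    have p2 : (0 : ℝ) < catalan (n + 1 + 1) := mod_cast catalan_pos _
    have hq : ((n : ℝ) + 3) / (2 * (2 * n + 3)) = catalan (n + 1) / catalan (n + 1 + 1) := by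
      rw [div_eq_div_iff (by positivity) p2.ne']
      linear_combination h
    simp only [hr]
    rw [hq, Finset.sum_range_succ]
    push_cast
    field_simp
  have hb (n : ℕ) : 0 ≤ r n - 1 / 3 ∧ r n - 1 / 3 ≤ 4 / (n + 3) := by
    induction n with
    | zero => norm_num [hr]
    | succ n ih =>
      obtain ⟨h0, h1⟩ := ih
      have e : r (n + 1) - 1 / 3 =
          (r n - 1 / 3) * ((n + 3) / (2 * (2 * n + 3))) + 1 / (2 * n + 3) := by
        rw [hrec]; field_simp; ring
      rw [e]
      refine ⟨by positivity, ?_⟩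
      calc _ ≤ 4 / ((n : ℝ) + 3) * ((n + 3) / (2 * (2 * n + 3))) + 1 / (2 * n + 3) := by gcongr
        _ = 3 / (2 * n + 3) := by field_simp; norm_num
        _ ≤ _ := by
          push_cast
          rw [div_le_div_iff₀ (by positivity) (by positivity)]
          linarith [(Nat.cast_nonneg n : (0 : ℝ) ≤ n)]
  have hlim : Filter.Tendsto (fun n : ℕ => (4 : ℝ) / (n + 3)) Filter.atTop (nhds 0) :=
    Filter.Tendsto.const_div_atTop
      (Filter.tendsto_atTop_add_const_right _ _ tendsto_natCast_atTop_atTop) _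
  have h := (squeeze_zero (fun n => (hb n).1) (fun n => (hb n).2) hlim).add_const (1 / 3)
  simp only [sub_add_cancel, zero_add] at h
  exact h

section OrderIso

variable {G : Type*} [CommGroup G] {n : ℕ} (e : Subgroup G ≃o Fin (n + 1))

/-- The transfer system attached to `f`: `H` transfers to `K` when `H ≤ K` and the index of `K`
in the chain of subgroups is at most `f` of the index of `H`. -/
def chainTransferSystem (f : ℕ → ℕ) : Set (Subgroup G × Subgroup G) :=
  {q | q.1 ≤ q.2 ∧ (e q.2 : ℕ) ≤ f (e q.1)}

variable {e}

lemma map_conj_eq (g : G) (H : Subgroup G) : H.map (MulAut.conj g).toMonoidHom = H := by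
  have : (MulAut.conj g).toMonoidHom = MonoidHom.id G := by ext x; simp
  rw [this, Subgroup.map_id]

lemma val_le_val_iff (H K : Subgroup G) : (e H : ℕ) ≤ e K ↔ H ≤ K := by
  rw [Fin.val_fin_le, e.le_iff_le]

lemma exists_val_eq {i : ℕ} (hi : i < n + 1) : ∃ H : Subgroup G, (e H : ℕ) = i :=
  ⟨e.symm ⟨i, hi⟩, by simp⟩

lemma val_top : (e ⊤ : ℕ) = n := by simp

lemma inf_eq_left_or_right (e : Subgroup G ≃o Fin (n + 1)) (H L : Subgroup G) :
    (H ≤ L ∧ H ⊓ L = H) ∨ (L ≤ H ∧ H ⊓ L = L) := by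
  rcases le_total (e H) (e L) with h | h
  · have h := e.le_iff_le.1 h
    exact .inl ⟨h, inf_eq_left.2 h⟩
  · have h := e.le_iff_le.1 h
    exact .inr ⟨h, inf_eq_right.2 h⟩

lemma isTransferSystem_chainTransferSystem {f : ℕ → ℕ} (hf : f ∈ chainClosures (n + 1)) :
    IsTransferSystem (chainTransferSystem e f) := by
  refine ⟨fun p hp => hp.1, fun H => ⟨le_rfl, hf.1 _⟩, fun H K L h1 h2 => ⟨h1.1.trans h2.1, ?_⟩,
    fun H K h g => by rwa [map_conj_eq, map_conj_eq], fun H K L h hL => ?_⟩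
  · exact h2.2.trans (hf.2.2.2 _ _ ((val_le_val_iff _ _).2 h1.1) h1.2)
  · rcases inf_eq_left_or_right e H L with ⟨h1, h2⟩ | ⟨-, h2⟩
    · rw [h2]
      exact ⟨h1, ((val_le_val_iff _ _).2 hL).trans h.2⟩
    · rw [h2]
      exact ⟨le_rfl, hf.1 _⟩

lemma chainTransferSystem_injOn :
    Set.InjOn (chainTransferSystem e) (chainClosures (n + 1)) := by
  have key : ∀ f ∈ chainClosures (n + 1), ∀ g ∈ chainClosures (n + 1),
      chainTransferSystem e f = chainTransferSystem e g → ∀ i < n + 1, f i ≤ g i := by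
    intro f hf g hg h i hi
    obtain ⟨H, hH⟩ := exists_val_eq (e := e) hi
    obtain ⟨K, hK⟩ := exists_val_eq (e := e) (hf.2.1 i hi)
    have hm : (H, K) ∈ chainTransferSystem e f :=
      ⟨(val_le_val_iff (e := e) _ _).1 (by rw [hH, hK]; exact hf.1 i), by simp [hH, hK]⟩
    rw [h] at hm
    simpa [hH, hK] using hm.2
  intro f hf g hg h
  ext i
  by_cases hi : i < n + 1
  · exact le_antisymm (key f hf g hg h i hi) (key g hg f hf h.symm i hi)
  · rw [hf.2.2.1 i (by omega), hg.2.2.1 i (by omega)]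

lemma exists_chainTransferSystem_eq (e : Subgroup G ≃o Fin (n + 1))
    {T : Set (Subgroup G × Subgroup G)} (hT : IsTransferSystem T) :
    ∃ f ∈ chainClosures (n + 1), chainTransferSystem e f = T := by
  classical
  obtain ⟨hle, hrefl, htrans, -, hres⟩ := hT
  let P (i j : ℕ) : Prop := ∃ q ∈ T, (e q.1 : ℕ) = i ∧ (e q.2 : ℕ) = j
  let f (i : ℕ) : ℕ := if i < n + 1 then Nat.findGreatest (P i) n else i
  have hP (H K : Subgroup G) : P (e H) (e K) ↔ (H, K) ∈ T := by
    refine ⟨?_, fun h => ⟨_, h, rfl, rfl⟩⟩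
    rintro ⟨⟨H', K'⟩, h, h1, h2⟩
    obtain rfl := e.injective (Fin.ext h1)
    obtain rfl := e.injective (Fin.ext h2)
    exact h
  have hfe (H : Subgroup G) : f (e H) = Nat.findGreatest (P (e H)) n := if_pos (e H).2
  have hself (H : Subgroup G) : P (e H) (e H) := (hP H H).2 (hrefl H)
  have hmem (H K : Subgroup G) (h : (H, K) ∈ T) : (e K : ℕ) ≤ f (e H) := by
    rw [hfe]
    exact Nat.le_findGreatest (by omega) ((hP H K).2 h)
  have hspec (H : Subgroup G) : P (e H) (f (e H)) := by
    rw [hfe]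
    exact Nat.findGreatest_spec (by omega) (hself H)
  have hlt (i : ℕ) (hi : i < n + 1) : f i < n + 1 := by
    simp only [f, if_pos hi]
    exact Nat.lt_succ_of_le (Nat.findGreatest_le n)
  have hiff (H K : Subgroup G) : (H, K) ∈ chainTransferSystem e f ↔ (H, K) ∈ T := by
    refine ⟨fun ⟨h1, h2⟩ => ?_, fun h => ⟨hle _ h, hmem H K h⟩⟩
    obtain ⟨L, hL⟩ := exists_val_eq (e := e) (hlt _ (e H).2)
    have h3 := hspec H
    rw [← hL] at h3 h2
    have := hres H L K ((hP H L).1 h3) ((val_le_val_iff _ _).1 h2)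
    rwa [inf_eq_left.2 h1] at this
  refine ⟨f, ⟨fun i => ?_, hlt, fun i hi => if_neg (by omega), fun i j hij hj => ?_⟩, ?_⟩
  · by_cases hi : i < n + 1
    · obtain ⟨H, rfl⟩ := exists_val_eq (e := e) hi
      exact hmem H H (hrefl H)
    · exact (if_neg hi).ge
  · by_cases hi : i < n + 1
    · have hi' := hlt i hi
      obtain ⟨H, rfl⟩ := exists_val_eq (e := e) hi
      obtain ⟨K, rfl⟩ := exists_val_eq (e := e) (i := j) (by omega)
      obtain ⟨L, hL⟩ := exists_val_eq (e := e) (hlt _ (e K).2)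
      have h3 := hspec K
      rw [← hL] at h3 ⊢
      exact hmem H L (htrans H K L ((hiff H K).1 ⟨(val_le_val_iff _ _).1 hij, hj⟩)
        ((hP K L).1 h3))
    · have h1 : f i = i := if_neg hi
      have h2 : f j = j := if_neg (by omega)
      omega
  · ext ⟨H, K⟩
    exact hiff H K

lemma isMinimalFibrant_chainTransferSystem_iff {f : ℕ → ℕ} (hf : f ∈ chainClosures (n + 1))
    (F : Subgroup G) : IsMinimalFibrant (chainTransferSystem e f) F ↔
      f (e F) = n ∧ ∀ i, f i = n → (e F : ℕ) ≤ i := by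
  have hmem (H : Subgroup G) : (H, ⊤) ∈ chainTransferSystem e f ↔ f (e H) = n := by
    have := hf.2.1 _ (e H).2
    simp only [chainTransferSystem, Set.mem_ofPred_eq, le_top, true_and, val_top]
    omega
  simp only [IsMinimalFibrant, hmem]
  refine and_congr_right fun _ => ⟨fun h i hi => ?_, fun h H hH => (val_le_val_iff _ _).1 (h _ hH)⟩
  obtain ⟨H, rfl⟩ := exists_val_eq (e := e) (i := i) (by have := hf.1 i; omega)
  exact (val_le_val_iff _ _).2 (h H hi)

lemma isFlat_chainTransferSystem_iff {f : ℕ → ℕ} (hf : f ∈ chainClosures (n + 1)) :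
    IsFlat (chainTransferSystem e f) ↔ ∃ k, f k = n ∧ ∀ i < k, f i = i := by
  simp only [IsFlat, isMinimalFibrant_chainTransferSystem_iff hf]
  constructor
  · intro h
    obtain ⟨k, hk, h1, h2⟩ := exists_split hf
    obtain ⟨F, rfl⟩ := exists_val_eq (e := e) (i := k) (by omega)
    refine ⟨_, h1, fun i hi => ?_⟩
    by_contra hne
    refine h F ⟨h1, fun j hj => ?_⟩ ?_
    · by_contra hlt
      have := h2 j (by omega)
      omega
    · have h3 := hf.1 i
      have h4 := h2 i hi
      obtain ⟨H, rfl⟩ := exists_val_eq (e := e) (i := i) (by omega)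
      obtain ⟨K, hK⟩ := exists_val_eq (e := e) (i := f (e H)) (by omega)
      refine ⟨H, K, ⟨(val_le_val_iff (e := e) H K).1 (by omega), hK.le⟩,
        lt_of_le_not_ge ((val_le_val_iff (e := e) _ _).1 (by omega)) fun hc => ?_,
        (val_le_val_iff (e := e) _ _).1 (by omega)⟩
      have := (val_le_val_iff (e := e) _ _).2 hc
      omega
  · rintro ⟨k, hk, hid⟩ F ⟨-, hF⟩ ⟨H, K, ⟨-, h2⟩, hlt, hKF⟩
    have h3 := hF k hk
    have h4 := (val_le_val_iff (e := e) _ _).2 hKF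
    have h5 : ¬ (e K : ℕ) ≤ e H := fun hc => hlt.not_ge ((val_le_val_iff _ _).1 hc)
    dsimp only at h2 hlt hKF h4 h5
    have := hid (e H) (by omega)
    omega

theorem card_transferSystems (e : Subgroup G ≃o Fin (n + 1)) :
    Nat.card {T : Set (Subgroup G × Subgroup G) // IsTransferSystem T} = catalan (n + 1) := by
  have h : {T : Set (Subgroup G × Subgroup G) | IsTransferSystem T} =
      chainTransferSystem e '' chainClosures (n + 1) := by
    ext T
    refine ⟨exists_chainTransferSystem_eq e, ?_⟩
    rintro ⟨f, hf, rfl⟩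
    exact isTransferSystem_chainTransferSystem hf
  rw [← ncard_chainClosures, ← (chainTransferSystem_injOn (e := e)).ncard_image, ← h]
  rfl

theorem card_flat_transferSystems (e : Subgroup G ≃o Fin (n + 1)) :
    Nat.card {T : Set (Subgroup G × Subgroup G) // IsTransferSystem T ∧ IsFlat T} =
      ∑ k ∈ Finset.range (n + 1), catalan k := by
  have h : {T : Set (Subgroup G × Subgroup G) | IsTransferSystem T ∧ IsFlat T} =
      chainTransferSystem e '' flatChainClosures n := by
    ext T
    constructor
    · rintro ⟨hT, hF⟩
      obtain ⟨f, hf, rfl⟩ := exists_chainTransferSystem_eq e hT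
      exact ⟨f, ⟨hf, (isFlat_chainTransferSystem_iff hf).1 hF⟩, rfl⟩
    · rintro ⟨f, ⟨hf, hk⟩, rfl⟩
      exact ⟨isTransferSystem_chainTransferSystem hf, (isFlat_chainTransferSystem_iff hf).2 hk⟩
  rw [← ncard_flatChainClosures,
    ← (chainTransferSystem_injOn (e := e) |>.mono fun f (hf : f ∈ flatChainClosures n) =>
      hf.1).ncard_image, ← h]
  rfl

end OrderIso

lemma IsCyclic.le_iff_card_dvd_card {G : Type*} [Group G] [Finite G] [IsCyclic G]
    (H K : Subgroup G) : H ≤ K ↔ Nat.card H ∣ Nat.card K := by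
  classical
  refine ⟨Subgroup.card_dvd_of_le, fun h x hx => ?_⟩
  have := Fintype.ofFinite G
  have hpow (L : Subgroup G) (a : G) (ha : a ∈ L) : a ^ Nat.card L = 1 :=
    congrArg Subtype.val (pow_card_eq_one' (x := (⟨a, ha⟩ : L)))
  have hsub : (K : Set G).toFinset ⊆ Finset.univ.filter fun a : G => a ^ Nat.card K = 1 := by
    intro a ha
    rw [Finset.mem_filter_univ]
    exact hpow K a (by simpa using ha)
  have heq := Finset.eq_of_subset_of_card_le hsub <| by
    refine (IsCyclic.card_pow_eq_one_le Nat.card_pos).trans ?_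
    rw [Set.toFinset_card, ← Nat.card_eq_fintype_card]
    rfl
  have hx' : x ∈ Finset.univ.filter fun a : G => a ^ Nat.card K = 1 := by
    obtain ⟨c, hc⟩ := h
    rw [Finset.mem_filter_univ, hc, pow_mul, hpow H x hx, one_pow]
  rw [← heq] at hx'
  simpa using hx'

theorem IsCyclic.nonempty_subgroup_orderIso_fin {G : Type*} [Group G] [Finite G] [IsCyclic G]
    {p n : ℕ} (hp : p.Prime) (hG : Nat.card G = p ^ n) :
    Nonempty (Subgroup G ≃o Fin (n + 1)) := by
  have : Fact p.Prime := ⟨hp⟩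
  have hex (H : Subgroup G) : ∃ k ≤ n, Nat.card H = p ^ k :=
    (Nat.dvd_prime_pow hp).1 (hG ▸ H.card_subgroup_dvd_card)
  choose c hc hcard using hex
  have hle (H K : Subgroup G) : c H ≤ c K ↔ H ≤ K := by
    rw [IsCyclic.le_iff_card_dvd_card, hcard, hcard, Nat.pow_dvd_pow_iff_le_right hp.one_lt]
  refine ⟨RelIso.ofSurjective (OrderEmbedding.ofMapLEIff
    (fun H => (⟨c H, Nat.lt_succ_of_le (hc H)⟩ : Fin (n + 1))) fun H K => hle H K) fun i => ?_⟩
  obtain ⟨H, hH⟩ := Sylow.exists_subgroup_card_pow_prime (G := G) p (n := i)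
    (hG ▸ pow_dvd_pow p (Nat.le_of_lt_succ i.2))
  exact ⟨H, Fin.ext (Nat.pow_right_injective hp.two_le ((hcard H).symm.trans hH))⟩

/-- The ratio of the number of flat transfer systems for `C_{p^n}` to the total number
of transfer systems for `C_{p^n}` tends to `1/3` as `n → ∞`; equivalently,
`lim_{n→∞} (∑_{k=0}^{n} Catalan(k)) / Catalan(n+1) = 1/3`. -/
theorem flat_transferSystems_ratio_tendsto_one_third (p : ℕ) (hp : p.Prime) :
    Filter.Tendsto (fun n : ℕ =>
      (Nat.card {T : Set (Subgroup (Multiplicative (ZMod (p ^ n))) ×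
          Subgroup (Multiplicative (ZMod (p ^ n)))) //
            IsTransferSystem T ∧ IsFlat T} : ℝ) /
      (Nat.card {T : Set (Subgroup (Multiplicative (ZMod (p ^ n))) ×
          Subgroup (Multiplicative (ZMod (p ^ n)))) // IsTransferSystem T} : ℝ))
      Filter.atTop (nhds (1 / 3)) ∧
    Filter.Tendsto (fun n : ℕ =>
      ((∑ k ∈ Finset.range (n + 1), catalan k : ℕ) : ℝ) / (catalan (n + 1) : ℝ))
      Filter.atTop (nhds (1 / 3)) := by
  have hcyc (n : ℕ) : Nonempty (Subgroup (Multiplicative (ZMod (p ^ n))) ≃o Fin (n + 1)) := by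
    have : NeZero (p ^ n) := ⟨(pow_pos hp.pos n).ne'⟩
    exact IsCyclic.nonempty_subgroup_orderIso_fin hp (by simp)
  refine ⟨tendsto_sum_catalan_div_catalan_succ.congr fun n => ?_,
    tendsto_sum_catalan_div_catalan_succ⟩
  obtain ⟨e⟩ := hcyc n
  rw [card_transferSystems e, card_flat_transferSystems e]
end

section
/- Let G be a finite abelian group. The number of saturated transfer systems for G equals the number of cosaturated transfer systems for G. -/
/-- The transfer system generated by a set `S` of pairs of subgroups. -/
def genTS {G : Type*} [Group G] (S : Set (Subgroup G × Subgroup G)) :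
    Set (Subgroup G × Subgroup G) :=
  ⋂₀ {T | IsTransferSystem T ∧ S ⊆ T}

/-- A transfer system is saturated if its pairs satisfy two-out-of-three. -/
def IsSaturated {G : Type*} [Group G] (T : Set (Subgroup G × Subgroup G)) : Prop :=
  ∀ H K L : Subgroup G, H ≤ K → K ≤ L →
    (((H, K) ∈ T ∧ (K, L) ∈ T) → (H, L) ∈ T) ∧
    (((H, K) ∈ T ∧ (H, L) ∈ T) → (K, L) ∈ T) ∧
    (((K, L) ∈ T ∧ (H, L) ∈ T) → (H, K) ∈ T)

/-- A transfer system is cosaturated if it is generated by pairs of the form `(H, G)`. -/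
def IsCosaturated {G : Type*} [Group G] (T : Set (Subgroup G × Subgroup G)) : Prop :=
  ∃ S : Set (Subgroup G × Subgroup G), (∀ p ∈ S, p.2 = ⊤) ∧ genTS S = T

theorem Subgroup.map_conj_eq_self {G : Type*} [CommGroup G] (g : G) (H : Subgroup G) :
    H.map (MulAut.conj g).toMonoidHom = H := by
  have h : (MulAut.conj g).toMonoidHom = MonoidHom.id G := by
    ext x
    simp
  rw [h, Subgroup.map_id]

/-- For commutative groups, the conjugation axiom of transfer systems is automatic. -/
theorem isTransferSystem_of_commGroup {G : Type*} [CommGroup G]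
    {T : Set (Subgroup G × Subgroup G)} (hle : ∀ p ∈ T, p.1 ≤ p.2)
    (hrefl : ∀ H : Subgroup G, (H, H) ∈ T)
    (htrans : ∀ H K L : Subgroup G, (H, K) ∈ T → (K, L) ∈ T → (H, L) ∈ T)
    (hres : ∀ H K L : Subgroup G, (H, K) ∈ T → L ≤ K → (H ⊓ L, L) ∈ T) :
    IsTransferSystem T :=
  ⟨hle, hrefl, htrans, fun H K h g ↦ by simpa only [Subgroup.map_conj_eq_self] using h, hres⟩

/-- The subgroups `X` such that `X ≤ K` implies `X ≤ H` for every pair `(H, K)` in `T`. -/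
def leftOrthogonal {G : Type*} [Group G] (T : Set (Subgroup G × Subgroup G)) :
    Set (Subgroup G) :=
  {X | ∀ H K, (H, K) ∈ T → X ≤ K → X ≤ H}

/-- The pairs `H ≤ K` of subgroups having the same members of `J` below them. -/
def rightOrthogonal {G : Type*} [Group G] (J : Set (Subgroup G)) :
    Set (Subgroup G × Subgroup G) :=
  {p | p.1 ≤ p.2 ∧ ∀ X ∈ J, X ≤ p.2 → X ≤ p.1}

/-- The pairs `(H, K)` of subgroups such that `H` is the intersection of `K` with a member
of `M`. -/
def restrictionPairs {G : Type*} [Group G] (M : Set (Subgroup G)) :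
    Set (Subgroup G × Subgroup G) :=
  {p | ∃ X ∈ M, p.1 = X ⊓ p.2}

theorem bot_mem_leftOrthogonal {G : Type*} [Group G] (T : Set (Subgroup G × Subgroup G)) :
    ⊥ ∈ leftOrthogonal T :=
  fun _ _ _ _ ↦ bot_le

theorem supClosed_leftOrthogonal {G : Type*} [Group G] (T : Set (Subgroup G × Subgroup G)) :
    SupClosed (leftOrthogonal T) :=
  fun _ hX _ hY H K h hle ↦ sup_le (hX H K h (le_sup_left.trans hle))
    (hY H K h (le_sup_right.trans hle))

theorem isTransferSystem_rightOrthogonal {G : Type*} [CommGroup G] (J : Set (Subgroup G)) :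
    IsTransferSystem (rightOrthogonal J) :=
  isTransferSystem_of_commGroup (fun _ hp ↦ hp.1) (fun _ ↦ ⟨le_rfl, fun _ _ h ↦ h⟩)
    (fun _ _ _ h₁ h₂ ↦ ⟨h₁.1.trans h₂.1, fun X hX h ↦ h₁.2 X hX (h₂.2 X hX h)⟩)
    (fun _ _ _ h hle ↦ ⟨inf_le_right, fun X hX hXL ↦ le_inf (h.2 X hX (hXL.trans hle)) hXL⟩)

theorem isSaturated_rightOrthogonal {G : Type*} [Group G] (J : Set (Subgroup G)) :
    IsSaturated (rightOrthogonal J) :=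
  fun _ _ _ hHK hKL ↦
    ⟨fun h ↦ ⟨hHK.trans hKL, fun X hX hXL ↦ h.1.2 X hX (h.2.2 X hX hXL)⟩,
      fun h ↦ ⟨hKL, fun X hX hXL ↦ (h.2.2 X hX hXL).trans hHK⟩,
      fun h ↦ ⟨hHK, fun X hX hXK ↦ h.2.2 X hX (hXK.trans hKL)⟩⟩

theorem leftOrthogonal_rightOrthogonal {G : Type*} [Group G] [Finite G] {J : Set (Subgroup G)}
    (hbot : ⊥ ∈ J) (hsup : SupClosed J) : leftOrthogonal (rightOrthogonal J) = J := by
  refine Set.Subset.antisymm (fun K hK ↦ ?_) fun X hX _ _ h hle ↦ h.2 X hX hle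
  have hle : sSup {X ∈ J | X ≤ K} ≤ K := sSup_le fun X hX ↦ hX.2
  have hmem : sSup {X ∈ J | X ≤ K} ∈ J :=
    hsup.sSup_mem (Set.toFinite _) hbot fun X hX ↦ hX.1
  have hK' := hK _ K ⟨hle, fun X hX hXK ↦ le_sSup (show X ∈ {X ∈ J | X ≤ K} from ⟨hX, hXK⟩)⟩
    le_rfl
  rwa [hle.antisymm hK'] at hmem

theorem rightOrthogonal_leftOrthogonal {G : Type*} [Group G] [Finite G]
    {T : Set (Subgroup G × Subgroup G)} (hT : IsTransferSystem T) (hsat : IsSaturated T) :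
    rightOrthogonal (leftOrthogonal T) = T := by
  obtain ⟨hle, hrefl, htrans, -, hres⟩ := hT
  refine Set.Subset.antisymm ?_ fun p hp ↦ ⟨hle p hp, fun X hX hXp ↦ hX _ _ hp hXp⟩
  rintro ⟨H, K⟩ ⟨hHK, h⟩
  obtain ⟨X, hX⟩ := (Set.toFinite {X | (X, K) ∈ T}).exists_minimal ⟨K, hrefl K⟩
  have hXJ : X ∈ leftOrthogonal T := fun C D hCD hXD ↦
    (hX.2 (htrans _ _ _ (hres C D X hCD hXD) hX.1) inf_le_right).trans inf_le_left
  have hXH : X ≤ H := h X hXJ (hle _ hX.1)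
  have hXHT : (X, H) ∈ T := by simpa [inf_eq_left.2 hXH] using hres X K H hX.1 hHK
  exact (hsat X H K hXH hHK).2.1 ⟨hXHT, hX.1⟩

/-- Saturated transfer systems correspond to join-closed sets of subgroups. -/
def saturatedEquivSupClosed (G : Type*) [CommGroup G] [Finite G] :
    {T : Set (Subgroup G × Subgroup G) // IsTransferSystem T ∧ IsSaturated T} ≃
      {J : Set (Subgroup G) // ⊥ ∈ J ∧ SupClosed J} where
  toFun T := ⟨leftOrthogonal T.1, bot_mem_leftOrthogonal _, supClosed_leftOrthogonal _⟩
  invFun J := ⟨rightOrthogonal J.1, isTransferSystem_rightOrthogonal _,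
    isSaturated_rightOrthogonal _⟩
  left_inv T := Subtype.ext (rightOrthogonal_leftOrthogonal T.2.1 T.2.2)
  right_inv J := Subtype.ext (leftOrthogonal_rightOrthogonal J.2.1 J.2.2)

theorem isTransferSystem_restrictionPairs {G : Type*} [CommGroup G] {M : Set (Subgroup G)}
    (htop : ⊤ ∈ M) (hinf : InfClosed M) : IsTransferSystem (restrictionPairs M) := by
  refine isTransferSystem_of_commGroup ?_ (fun H ↦ ⟨⊤, htop, top_inf_eq H |>.symm⟩) ?_ ?_
  · rintro p ⟨X, -, hX⟩
    exact hX.trans_le inf_le_right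
  · rintro H K L ⟨X, hX, hH⟩ ⟨Y, hY, hK⟩
    refine ⟨X ⊓ Y, hinf hX hY, ?_⟩
    dsimp only at hH hK ⊢
    rw [hH, hK, inf_assoc]
  · rintro H K L ⟨X, hX, hH⟩ hLK
    refine ⟨X, hX, ?_⟩
    dsimp only at hH ⊢
    rw [hH, inf_assoc, inf_eq_right.2 hLK]

theorem mk_top_mem_restrictionPairs {G : Type*} [Group G] {M : Set (Subgroup G)}
    {H : Subgroup G} : (H, ⊤) ∈ restrictionPairs M ↔ H ∈ M := by
  simp [restrictionPairs]

theorem restrictionPairs_subset {G : Type*} [Group G] {M : Set (Subgroup G)}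
    {T : Set (Subgroup G × Subgroup G)} (hT : IsTransferSystem T)
    (h : ∀ H ∈ M, (H, ⊤) ∈ T) : restrictionPairs M ⊆ T := by
  rintro ⟨H, K⟩ ⟨X, hX, hH⟩
  dsimp only at hH
  exact hH ▸ hT.2.2.2.2 X ⊤ K (h X hX) le_top

theorem isCosaturated_restrictionPairs {G : Type*} [CommGroup G] {M : Set (Subgroup G)}
    (htop : ⊤ ∈ M) (hinf : InfClosed M) : IsCosaturated (restrictionPairs M) := by
  refine ⟨{p | p.1 ∈ M ∧ p.2 = ⊤}, fun p hp ↦ hp.2, Set.Subset.antisymm ?_ ?_⟩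
  · refine Set.sInter_subset_of_mem ⟨isTransferSystem_restrictionPairs htop hinf, ?_⟩
    rintro ⟨H, _⟩ ⟨hH, rfl⟩
    exact mk_top_mem_restrictionPairs.2 hH
  · exact Set.subset_sInter fun T hT ↦ restrictionPairs_subset hT.1 fun H hH ↦ hT.2 ⟨hH, rfl⟩

theorem IsTransferSystem.infClosed {G : Type*} [Group G] {T : Set (Subgroup G × Subgroup G)}
    (hT : IsTransferSystem T) : InfClosed {H | (H, ⊤) ∈ T} :=
  fun H hH K hK ↦ hT.2.2.1 _ _ _ (hT.2.2.2.2 H ⊤ K hH le_top) hK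

theorem restrictionPairs_eq {G : Type*} [CommGroup G] {T : Set (Subgroup G × Subgroup G)}
    (hT : IsTransferSystem T) (hco : IsCosaturated T) :
    restrictionPairs {H | (H, ⊤) ∈ T} = T := by
  refine Set.Subset.antisymm (restrictionPairs_subset hT fun _ hH ↦ hH) ?_
  obtain ⟨S, hS, hgen⟩ := hco
  have hST : S ⊆ T := hgen ▸ Set.subset_sInter fun T' hT' ↦ hT'.2
  conv_lhs => rw [← hgen]
  refine Set.sInter_subset_of_mem
    ⟨isTransferSystem_restrictionPairs (hT.2.1 ⊤) hT.infClosed, ?_⟩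
  rintro ⟨H, K⟩ hp
  obtain rfl : K = ⊤ := hS _ hp
  exact mk_top_mem_restrictionPairs.2 (hST hp)

/-- Cosaturated transfer systems correspond to intersection-closed sets of subgroups. -/
def cosaturatedEquivInfClosed (G : Type*) [CommGroup G] :
    {T : Set (Subgroup G × Subgroup G) // IsTransferSystem T ∧ IsCosaturated T} ≃
      {M : Set (Subgroup G) // ⊤ ∈ M ∧ InfClosed M} where
  toFun T := ⟨{H | (H, ⊤) ∈ T.1}, T.2.1.2.1 ⊤, T.2.1.infClosed⟩
  invFun M := ⟨restrictionPairs M.1, isTransferSystem_restrictionPairs M.2.1 M.2.2,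
    isCosaturated_restrictionPairs M.2.1 M.2.2⟩
  left_inv T := Subtype.ext (restrictionPairs_eq T.2.1 T.2.2)
  right_inv _ := Subtype.ext (Set.ext fun _ ↦ mk_top_mem_restrictionPairs)

/-- The subgroup lattice of a finite abelian group is self-dual. -/
theorem nonempty_subgroup_orderIso_dual (G : Type*) [CommGroup G] [Finite G] :
    Nonempty (Subgroup G ≃o (Subgroup G)ᵒᵈ) := by
  have : NeZero (Monoid.exponent G) := ⟨Monoid.exponent_ne_zero_of_finite⟩
  obtain ⟨e⟩ := CommGroup.monoidHom_mulEquiv_of_hasEnoughRootsOfUnity G ℂ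
  exact ⟨(CommGroup.subgroupOrderIsoSubgroupMonoidHom G ℂ).trans e.mapSubgroup.dual⟩

/-- An anti-automorphism of a bounded lattice exchanges join-closed and meet-closed subsets. -/
def OrderIso.supClosedEquivInfClosed {α : Type*} [Lattice α] [BoundedOrder α] (e : α ≃o αᵒᵈ) :
    {J : Set α // ⊥ ∈ J ∧ SupClosed J} ≃ {M : Set α // ⊤ ∈ M ∧ InfClosed M} :=
  (Equiv.Set.congr (e.toEquiv.trans OrderDual.ofDual)).subtypeEquiv fun J ↦ by
    have hf (x y : α) : OrderDual.ofDual (e (x ⊔ y)) =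
      OrderDual.ofDual (e x) ⊓ OrderDual.ofDual (e y) := by rw [map_sup, ofDual_sup]
    have htop : OrderDual.ofDual (e ⊥) = ⊤ := by rw [map_bot, OrderDual.ofDual_bot]
    have hinj : Function.Injective fun x ↦ OrderDual.ofDual (e x) :=
      OrderDual.ofDual.injective.comp e.injective
    change _ ↔ ⊤ ∈ (fun x ↦ OrderDual.ofDual (e x)) '' J ∧
      InfClosed ((fun x ↦ OrderDual.ofDual (e x)) '' J)
    refine and_congr ?_ ⟨?_, fun h x hx y hy ↦ ?_⟩
    · rw [← htop]
      exact (hinj.mem_set_image (a := ⊥)).symm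
    · rintro h _ ⟨x, hx, rfl⟩ _ ⟨y, hy, rfl⟩
      exact ⟨x ⊔ y, h hx hy, hf x y⟩
    · rw [← hinj.mem_set_image (a := x ⊔ y)]
      exact (hf x y).symm ▸ h ⟨x, hx, rfl⟩ ⟨y, hy, rfl⟩

/-- For a finite abelian group `G`, the number of saturated transfer systems equals
the number of cosaturated transfer systems. -/
theorem card_saturated_eq_card_cosaturated {G : Type*} [CommGroup G] [Finite G] :
    Nat.card {T : Set (Subgroup G × Subgroup G) // IsTransferSystem T ∧ IsSaturated T} =
    Nat.card {T : Set (Subgroup G × Subgroup G) // IsTransferSystem T ∧ IsCosaturated T} := by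
  obtain ⟨e⟩ := nonempty_subgroup_orderIso_dual G
  exact Nat.card_congr ((saturatedEquivSupClosed G).trans
    (e.supClosedEquivInfClosed.trans (cosaturatedEquivInfClosed G).symm))
end

section
/- Let G be a finite group and T a transfer system for G. The set {H ≤ G : (H, G) ∈ T} has a unique minimal element F, i.e., (F, G) ∈ T and F ≤ H for every subgroup H with (H, G) ∈ T; moreover F is a normal subgroup of G. -/
/-- The fibrant subgroups of a transfer system are closed under intersection. -/
theorem IsTransferSystem.inf_top_mem {G : Type*} [Group G] {T : Set (Subgroup G × Subgroup G)}
    (hT : IsTransferSystem T) {H K : Subgroup G} (hH : (H, ⊤) ∈ T) (hK : (K, ⊤) ∈ T) :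
    (H ⊓ K, ⊤) ∈ T := by
  obtain ⟨-, -, htrans, -, hres⟩ := hT
  exact htrans _ _ _ (hres _ _ _ hH le_top) hK

/-- The fibrant subgroups of a transfer system are closed under conjugation. -/
theorem IsTransferSystem.map_conj_top_mem {G : Type*} [Group G]
    {T : Set (Subgroup G × Subgroup G)} (hT : IsTransferSystem T) {H : Subgroup G}
    (hH : (H, ⊤) ∈ T) (g : G) :
    (Subgroup.map (MulAut.conj g).toMonoidHom H, ⊤) ∈ T := by
  obtain ⟨-, -, -, hconj, -⟩ := hT
  have h := hconj _ _ hH g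
  rwa [Subgroup.map_top_of_surjective _ (MulAut.conj g).surjective] at h

/-- For a transfer system `T` for a finite group `G`, the set
`{H ≤ G : (H, G) ∈ T}` has a unique minimal element `F` (the minimal fibrant
subgroup), and `F` is a normal subgroup of `G`. -/
theorem exists_unique_minimal_fibrant_subgroup_and_normal
    {G : Type*} [Group G] [Finite G] (T : Set (Subgroup G × Subgroup G))
    (hT : IsTransferSystem T) :
    ∃! F : Subgroup G, ((F, ⊤) ∈ T ∧ ∀ H : Subgroup G, (H, ⊤) ∈ T → F ≤ H) ∧
      F.Normal := by
  obtain ⟨F, hF⟩ := (Set.toFinite {H : Subgroup G | (H, ⊤) ∈ T}).exists_minimal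
    ⟨⊤, hT.2.1 ⊤⟩
  have hle : ∀ H : Subgroup G, (H, ⊤) ∈ T → F ≤ H := fun H hH =>
    (hF.le_of_le (hT.inf_top_mem hF.prop hH) inf_le_left).trans inf_le_right
  refine ⟨F, ⟨⟨hF.prop, hle⟩, ⟨fun n hn g => ?_⟩⟩,
    fun F' h => le_antisymm (h.1.2 F hF.prop) (hle F' h.1.1)⟩
  obtain ⟨m, hm, rfl⟩ := hle _ (hT.map_conj_top_mem hF.prop g⁻¹) hn
  simpa [mul_assoc] using hm
end

section
/- Let G be a finite group and T a transfer system for G. There exists a unique saturated transfer system T̄ (the saturated hull of T) such that T ⊆ T̄ and T̄ ⊆ S for every saturated transfer system S with T ⊆ S. -/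
/-- Every transfer system `T` for a finite group `G` has a unique saturated hull:
a saturated transfer system containing `T` and contained in every saturated
transfer system containing `T`. -/
theorem exists_unique_saturated_hull
    {G : Type*} [Group G] [Finite G] (T : Set (Subgroup G × Subgroup G))
    (hT : IsTransferSystem T) :
    ∃! Tbar : Set (Subgroup G × Subgroup G),
      (IsTransferSystem Tbar ∧ IsSaturated Tbar ∧ T ⊆ Tbar) ∧
      ∀ S : Set (Subgroup G × Subgroup G),
        IsTransferSystem S → IsSaturated S → T ⊆ S → Tbar ⊆ S := by
  refine ⟨{p | p.1 ≤ p.2 ∧ ∀ S : Set (Subgroup G × Subgroup G),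
    IsTransferSystem S → IsSaturated S → T ⊆ S → p ∈ S},
    ⟨⟨⟨fun p hp => hp.1, fun H => ⟨le_rfl, fun S hS _ _ => hS.2.1 H⟩, ?_, ?_, ?_⟩, ?_, ?_⟩, ?_⟩, ?_⟩
  · intro H K L hHK hKL
    exact ⟨hHK.1.trans hKL.1, fun S hS hsat hTS =>
      hS.2.2.1 H K L (hHK.2 S hS hsat hTS) (hKL.2 S hS hsat hTS)⟩
  · intro H K hHK g
    exact ⟨Subgroup.map_mono hHK.1, fun S hS hsat hTS =>
      hS.2.2.2.1 H K (hHK.2 S hS hsat hTS) g⟩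
  · intro H K L hHK hLK
    exact ⟨inf_le_right, fun S hS hsat hTS =>
      hS.2.2.2.2 H K L (hHK.2 S hS hsat hTS) hLK⟩
  · intro H K L hHK hKL
    refine ⟨fun h => ⟨hHK.trans hKL, fun S hS hsat hTS => ?_⟩,
      fun h => ⟨hKL, fun S hS hsat hTS => ?_⟩, fun h => ⟨hHK, fun S hS hsat hTS => ?_⟩⟩
    · exact (hsat H K L hHK hKL).1 ⟨h.1.2 S hS hsat hTS, h.2.2 S hS hsat hTS⟩
    · exact (hsat H K L hHK hKL).2.1 ⟨h.1.2 S hS hsat hTS, h.2.2 S hS hsat hTS⟩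
    · exact (hsat H K L hHK hKL).2.2 ⟨h.1.2 S hS hsat hTS, h.2.2 S hS hsat hTS⟩
  · exact fun p hp => ⟨hT.1 p hp, fun S _ _ hTS => hTS hp⟩
  · exact fun S hS hsat hTS p hp => hp.2 S hS hsat hTS
  · rintro S ⟨⟨hS, hsat, hTS⟩, hmin⟩
    exact Set.Subset.antisymm
      (fun p hp => ⟨hS.1 p hp, fun S' hS' hsat' hTS' => hmin S' hS' hsat' hTS' hp⟩)
      (fun p hp => hp.2 S hS hsat hTS)
end

section
/- Let G be a finite group and T a transfer system for G. The transfer system generated by the set {(H, G) : (H, G) ∈ T} is contained in T, is cosaturated, and contains every cosaturated transfer system contained in T; hence T contains a unique maximal cosaturated transfer system (its cosaturated core). -/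
section genTS

variable {G : Type*} [Group G] {S S' T : Set (Subgroup G × Subgroup G)}

theorem subset_genTS (S : Set (Subgroup G × Subgroup G)) : S ⊆ genTS S :=
  Set.subset_sInter fun _ hT => hT.2

theorem genTS_subset (hT : IsTransferSystem T) (hST : S ⊆ T) : genTS S ⊆ T :=
  Set.sInter_subset_of_mem ⟨hT, hST⟩

theorem genTS_mono (h : S ⊆ S') : genTS S ⊆ genTS S' :=
  Set.sInter_subset_sInter fun _ hT => ⟨hT.1, h.trans hT.2⟩

/-- If `S` is contained in some transfer system, then `genTS S` is a transfer system. -/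
theorem isTransferSystem_genTS (hT : IsTransferSystem T) (hST : S ⊆ T) :
    IsTransferSystem (genTS S) := by
  refine ⟨fun p hp => hT.1 p (genTS_subset hT hST hp), fun H U hU => hU.1.2.1 H,
    fun H K L hHK hKL U hU => hU.1.2.2.1 H K L (hHK U hU) (hKL U hU),
    fun H K hHK g U hU => hU.1.2.2.2.1 H K (hHK U hU) g,
    fun H K L hHK hLK U hU => hU.1.2.2.2.2 H K L (hHK U hU) hLK⟩

end genTS

/-- For a transfer system `T` for a finite group `G`, the transfer system generated by
`{(H, G) : (H, G) ∈ T}` is contained in `T`, is a cosaturated transfer system, and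
contains every cosaturated transfer system contained in `T`; hence it is the unique
maximal cosaturated transfer system contained in `T` (the cosaturated core). -/
theorem cosaturated_core
    {G : Type*} [Group G] [Finite G] (T : Set (Subgroup G × Subgroup G))
    (hT : IsTransferSystem T) :
    genTS {p ∈ T | p.2 = ⊤} ⊆ T ∧
    IsTransferSystem (genTS {p ∈ T | p.2 = ⊤}) ∧
    IsCosaturated (genTS {p ∈ T | p.2 = ⊤}) ∧
    (∀ U : Set (Subgroup G × Subgroup G),
      IsTransferSystem U → IsCosaturated U → U ⊆ T → U ⊆ genTS {p ∈ T | p.2 = ⊤}) := by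
  have hsub : {p ∈ T | p.2 = ⊤} ⊆ T := Set.sep_subset _ _
  refine ⟨genTS_subset hT hsub, isTransferSystem_genTS hT hsub, ⟨_, fun p hp => hp.2, rfl⟩, ?_⟩
  rintro U - ⟨S, hS, rfl⟩ hU
  exact genTS_mono fun p hp => ⟨hU (subset_genTS S hp), hS p hp⟩
end

section
/- Let G be a finite group in which every subgroup is normal (a Dedekind group). Then a class ℛ of pairs of subgroups (C, D) with C ≤ D is the right class of a weak factorization system on the subgroup lattice Sub(G) if and only if ℛ is a transfer system for G; in particular, the assignment (ℒ, ℛ) ↦ ℛ is a bijection from weak factorization systems on Sub(G) to transfer systems for G. -/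
/-- The class of pairs `(A, B)` with `A ≤ B` having the left lifting property
against every member of `R`. -/
def llp {G : Type*} [Group G] (R : Set (Subgroup G × Subgroup G)) :
    Set (Subgroup G × Subgroup G) :=
  {p | p.1 ≤ p.2 ∧ ∀ q ∈ R, p.1 ≤ q.1 → p.2 ≤ q.2 → p.2 ≤ q.1}

/-- The class of pairs `(C, D)` with `C ≤ D` such that every member of `Lc` has
the left lifting property against `(C, D)`. -/
def rlp {G : Type*} [Group G] (Lc : Set (Subgroup G × Subgroup G)) :
    Set (Subgroup G × Subgroup G) :=
  {q | q.1 ≤ q.2 ∧ ∀ p ∈ Lc, p.1 ≤ q.1 → p.2 ≤ q.2 → p.2 ≤ q.1}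

/-- A weak factorization system on the subgroup lattice `Sub(G)`: a pair of classes
`(Lc, Rc)` with `Lc = llp Rc`, `Rc = rlp Lc`, and every pair `A ≤ B` factoring
as `A ≤ M ≤ B` with `(A, M) ∈ Lc` and `(M, B) ∈ Rc`. -/
def IsWFS {G : Type*} [Group G] (Lc Rc : Set (Subgroup G × Subgroup G)) : Prop :=
  Lc = llp Rc ∧ Rc = rlp Lc ∧
  ∀ A B : Subgroup G, A ≤ B → ∃ M : Subgroup G, A ≤ M ∧ M ≤ B ∧
    (A, M) ∈ Lc ∧ (M, B) ∈ Rc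

theorem Subgroup.Normal.map_mulAut_conj {G : Type*} [Group G] {H : Subgroup G} (hH : H.Normal)
    (g : G) : Subgroup.map (MulAut.conj g).toMonoidHom H = H := by
  have := hH
  exact Subgroup.Normal.conj_smul_eq_self g H

/-- In a Dedekind group, every class defined by a right lifting property is a transfer system. -/
theorem isTransferSystem_rlp {G : Type*} [Group G] (hG : ∀ H : Subgroup G, H.Normal)
    (Lc : Set (Subgroup G × Subgroup G)) : IsTransferSystem (rlp Lc) := by
  refine ⟨fun p hp => hp.1, fun H => ⟨le_rfl, fun p _ _ h => h⟩, ?_, ?_, ?_⟩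
  · intro H K L hHK hKL
    exact ⟨hHK.1.trans hKL.1, fun p hp h₁ h₂ =>
      hHK.2 p hp h₁ (hKL.2 p hp (h₁.trans hHK.1) h₂)⟩
  · intro H K hHK g
    rwa [(hG H).map_mulAut_conj, (hG K).map_mulAut_conj]
  · intro H K L hHK hLK
    exact ⟨inf_le_right, fun p hp h₁ h₂ =>
      le_inf (hHK.2 p hp (h₁.trans inf_le_left) (h₂.trans hLK)) h₂⟩

/-- A transfer system on a finite group factors every pair: the middle term is a minimal
subgroup above `A` that transfers to `B`. -/
theorem IsTransferSystem.exists_factorization {G : Type*} [Group G] [Finite G]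
    {T : Set (Subgroup G × Subgroup G)} (hT : IsTransferSystem T) {A B : Subgroup G}
    (hAB : A ≤ B) : ∃ M : Subgroup G, A ≤ M ∧ M ≤ B ∧ (A, M) ∈ llp T ∧ (M, B) ∈ T := by
  obtain ⟨hle, hid, hcomp, -, hres⟩ := hT
  obtain ⟨M, hM⟩ := (Set.toFinite {M : Subgroup G | A ≤ M ∧ (M, B) ∈ T}).exists_minimal
    ⟨B, hAB, hid B⟩
  obtain ⟨hAM, hMB⟩ := hM.prop
  refine ⟨M, hAM, hle _ hMB, ⟨hAM, ?_⟩, hMB⟩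
  rintro ⟨C, D⟩ hCD hAC hMD
  have hmem : C ⊓ M ∈ {M : Subgroup G | A ≤ M ∧ (M, B) ∈ T} :=
    ⟨le_inf hAC hAM, hcomp _ _ _ (hres C D M hCD hMD) hMB⟩
  exact (hM.le_of_le hmem inf_le_right).trans inf_le_left

/-- A transfer system on a finite group is the right class of a weak factorization system. -/
theorem IsTransferSystem.isWFS {G : Type*} [Group G] [Finite G]
    {T : Set (Subgroup G × Subgroup G)} (hT : IsTransferSystem T) : IsWFS (llp T) T := by
  refine ⟨rfl, Set.Subset.antisymm ?_ ?_, fun A B hAB => hT.exists_factorization hAB⟩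
  · exact fun q hq => ⟨hT.1 q hq, fun p hp => hp.2 q hq⟩
  · rintro ⟨C, D⟩ ⟨hCD, hlift⟩
    obtain ⟨M, hCM, hMD, hL, hR⟩ := hT.exists_factorization (A := C) (B := D) hCD
    rwa [le_antisymm hCM (hlift _ hL le_rfl hMD)]

/-- In a Dedekind group, the right class of a weak factorization system is a transfer system. -/
theorem IsWFS.isTransferSystem {G : Type*} [Group G] (hG : ∀ H : Subgroup G, H.Normal)
    {Lc Rc : Set (Subgroup G × Subgroup G)} (h : IsWFS Lc Rc) : IsTransferSystem Rc :=
  h.2.1 ▸ isTransferSystem_rlp hG Lc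

/-- For a finite Dedekind group `G` (every subgroup normal), a class `R` of pairs of
subgroups is the right class of a weak factorization system on `Sub(G)` if and only
if `R` is a transfer system for `G`; in particular, `(Lc, Rc) ↦ Rc` is a bijection
from weak factorization systems on `Sub(G)` to transfer systems for `G`. -/
theorem wfs_right_class_iff_transferSystem
    {G : Type*} [Group G] [Finite G] (hG : ∀ H : Subgroup G, H.Normal) :
    (∀ R : Set (Subgroup G × Subgroup G),
      (∃ Lc : Set (Subgroup G × Subgroup G), IsWFS Lc R) ↔ IsTransferSystem R) ∧
    (∃ e : {P : Set (Subgroup G × Subgroup G) × Set (Subgroup G × Subgroup G) //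
          IsWFS P.1 P.2} ≃
        {T : Set (Subgroup G × Subgroup G) // IsTransferSystem T},
      ∀ W, (e W).1 = W.1.2) := by
  refine ⟨fun R => ⟨fun ⟨_, h⟩ => h.isTransferSystem hG, fun h => ⟨_, h.isWFS⟩⟩, ?_⟩
  exact ⟨{
    toFun := fun W => ⟨W.1.2, W.2.isTransferSystem hG⟩
    invFun := fun T => ⟨(llp T.1, T.1), T.2.isWFS⟩
    left_inv := fun W => Subtype.ext (Prod.ext W.2.1.symm rfl)
    right_inv := fun _ => rfl }, fun _ => rfl⟩
end

section
/- Let G be a finite cyclic group. The lattice of transfer systems for G admits a self-duality: there is a bijection D from the set of transfer systems for G to itself such that D(D(T)) = T for every transfer system T, and T ⊆ T' if and only if D(T') ⊆ D(T). -/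
/-- The relations on a meet-semilattice satisfying all the axioms of a transfer system except
conjugation. -/
structure IsLatticeTransfer {α : Type*} [SemilatticeInf α] (T : Set (α × α)) : Prop where
  le : ∀ {a b}, (a, b) ∈ T → a ≤ b
  refl : ∀ a, (a, a) ∈ T
  trans : ∀ {a b c}, (a, b) ∈ T → (b, c) ∈ T → (a, c) ∈ T
  restrict : ∀ {a b c}, (a, b) ∈ T → c ≤ b → (a ⊓ c, c) ∈ T

/-- The image under `f` of the pairs with the left lifting property against `T`, for an
order-reversing involution `f`. -/
def liftingDual {α : Type*} [SemilatticeInf α] (f : α → α) (T : Set (α × α)) : Set (α × α) :=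
  {p | p.1 ≤ p.2 ∧ ∀ x, (x, f p.1) ∈ T → f p.2 ≤ x → x = f p.1}

theorem liftingDual_anti {α : Type*} [SemilatticeInf α] (f : α → α) {T T' : Set (α × α)}
    (h : T ⊆ T') : liftingDual f T' ⊆ liftingDual f T :=
  fun _ hp => ⟨hp.1, fun x hx => hp.2 x (h hx)⟩

theorem IsLatticeTransfer.liftingDual {α : Type*} [SemilatticeInf α] {f : α → α}
    (hf : Antitone f) (hff : Function.Involutive f) {T : Set (α × α)}
    (hT : IsLatticeTransfer T) : IsLatticeTransfer (liftingDual f T) where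
  le h := h.1
  refl a := ⟨le_rfl, fun _ hx hle => le_antisymm (hT.le hx) hle⟩
  trans {a b c} hab hbc := by
    refine ⟨hab.1.trans hbc.1, fun x hx hcx => hab.2 x hx ?_⟩
    have h := hbc.2 (x ⊓ f b) (hT.restrict hx (hf hab.1)) (le_inf hcx (hf hbc.1))
    exact inf_eq_right.mp h
  restrict {a b c} hab hcb := by
    refine ⟨inf_le_right, fun x hx hcx => le_antisymm (hT.le hx) ?_⟩
    have h := hab.2 (x ⊓ f a) (hT.restrict hx (hf inf_le_left))
      (le_inf ((hf hcb).trans hcx) (hf hab.1))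
    have hxa : f x ≤ a := hff a ▸ hf (inf_eq_right.mp h)
    have hxc : f x ≤ c := hff c ▸ hf hcx
    exact hff x ▸ hf (le_inf hxa hxc)

theorem IsLatticeTransfer.liftingDual_liftingDual {α : Type*} [SemilatticeInf α] [Finite α]
    {f : α → α} (hf : Antitone f) (hff : Function.Involutive f) {T : Set (α × α)}
    (hT : IsLatticeTransfer T) : _root_.liftingDual f (_root_.liftingDual f T) = T := by
  ext ⟨a, b⟩
  constructor
  · rintro ⟨hab, h⟩
    obtain ⟨m, ⟨ham, hmb⟩, hmin⟩ :=
      (Set.toFinite {m | a ≤ m ∧ (m, b) ∈ T}).exists_minimal ⟨b, hab, hT.refl b⟩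
    have hma : f m = f a := by
      refine h (f m) ⟨hf ham, fun y hy hay => ?_⟩ (hf (hT.le hmb))
      simp only [hff m, hff a] at hy hay ⊢
      exact le_antisymm (hT.le hy) (hmin ⟨hay, hT.trans hy hmb⟩ (hT.le hy))
    exact hff.injective hma ▸ hmb
  · intro h
    refine ⟨hT.le h, fun x hx hbx => ?_⟩
    have hax : a ≤ f x := hff a ▸ hf hx.1
    have hxb : f x ≤ b := hff b ▸ hf hbx
    have hmem : (a, f x) ∈ T := inf_eq_left.mpr hax ▸ hT.restrict h hxb
    rw [hx.2 a hmem (hff a).le, hff x]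

/-- The subgroups of a finite cyclic group admit an order-reversing involution. -/
theorem IsCyclic.exists_antitone_involutive_subgroup {G : Type*} [CommGroup G] [Finite G]
    [IsCyclic G] : ∃ f : Subgroup G → Subgroup G, Antitone f ∧ Function.Involutive f := by
  have hcard (H : Subgroup G) : Nat.card (powMonoidHom H.index : G →* G).ker = H.index := by
    rw [IsCyclic.card_powMonoidHom_ker, Nat.gcd_eq_right H.index_dvd_card]
  have hindex (H : Subgroup G) : (powMonoidHom H.index : G →* G).ker.index = Nat.card H := by
    have h := (powMonoidHom H.index : G →* G).ker.card_mul_index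
    rw [hcard, ← H.index_mul_card] at h
    exact Nat.eq_of_mul_eq_mul_left (Nat.pos_of_ne_zero H.index_ne_zero_of_finite) h
  refine ⟨fun H => (powMonoidHom H.index : G →* G).ker, fun H K hHK g hg => ?_, fun H => ?_⟩
  · obtain ⟨k, hk⟩ := Subgroup.index_dvd_of_le hHK
    simp only [MonoidHom.mem_ker, powMonoidHom_apply] at hg ⊢
    rw [hk, pow_mul, hg, one_pow]
  · refine (Subgroup.eq_of_le_of_card_ge (fun g hg => ?_) ?_).symm
    · simp only [MonoidHom.mem_ker, powMonoidHom_apply, hindex]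
      exact congrArg Subtype.val (pow_card_eq_one' (x := (⟨g, hg⟩ : H)))
    · rw [hcard, hindex]

theorem isTransferSystem_iff_isLatticeTransfer {G : Type*} [Group G] [IsMulCommutative G]
    {T : Set (Subgroup G × Subgroup G)} : IsTransferSystem T ↔ IsLatticeTransfer T := by
  have hconj (g : G) (H : Subgroup G) : H.map (MulAut.conj g).toMonoidHom = H := by
    have : (MulAut.conj g).toMonoidHom = MonoidHom.id G := by
      ext x
      simp [mul_comm' g x]
    rw [this, Subgroup.map_id]
  constructor
  · rintro ⟨hle, hrefl, htrans, -, hres⟩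
    exact ⟨fun h => hle _ h, hrefl, htrans _ _ _, hres _ _ _⟩
  · intro h
    refine ⟨fun _ hp => h.le hp, h.refl, fun _ _ _ => h.trans, fun H K hHK g => ?_,
      fun _ _ _ => h.restrict⟩
    rwa [hconj, hconj]

/-- For a finite cyclic group `G`, the lattice of transfer systems for `G` admits a
self-duality: an involution `D` on transfer systems with `T ⊆ T' ↔ D T' ⊆ D T`. -/
theorem transferSystems_self_duality
    {G : Type*} [Group G] [Finite G] (hG : IsCyclic G) :
    ∃ D : {T : Set (Subgroup G × Subgroup G) // IsTransferSystem T} →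
        {T : Set (Subgroup G × Subgroup G) // IsTransferSystem T},
      (∀ T, D (D T) = T) ∧
      ∀ T T' : {T : Set (Subgroup G × Subgroup G) // IsTransferSystem T},
        T.1 ⊆ T'.1 ↔ (D T').1 ⊆ (D T).1 := by
  have : IsMulCommutative G := inferInstance
  obtain ⟨f, hf, hff⟩ : ∃ f : Subgroup G → Subgroup G, Antitone f ∧ Function.Involutive f :=
    letI := IsCyclic.commGroup (α := G)
    IsCyclic.exists_antitone_involutive_subgroup
  have hdual (T : {T : Set (Subgroup G × Subgroup G) // IsTransferSystem T}) :
      liftingDual f (liftingDual f T.1) = T.1 :=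
    (isTransferSystem_iff_isLatticeTransfer.mp T.2).liftingDual_liftingDual hf hff
  refine ⟨fun T => ⟨liftingDual f T.1, isTransferSystem_iff_isLatticeTransfer.mpr
    ((isTransferSystem_iff_isLatticeTransfer.mp T.2).liftingDual hf hff)⟩,
    fun T => Subtype.ext (hdual T), fun T T' => ⟨liftingDual_anti f, fun h => ?_⟩⟩
  rw [← hdual T, ← hdual T']
  exact liftingDual_anti f h
end

section
/- Let G be a finite group and T a transfer system for G. Any two generating sets of T consisting of pairs (H, K) with H < K that are minimal with respect to inclusion (no proper subset generates T) have the same cardinality. -/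
namespace TransferSystem

variable {G : Type*} [Group G]

/-- The conjugate `gHg⁻¹` of a subgroup. -/
abbrev conjSubgroup (g : G) (H : Subgroup G) : Subgroup G :=
  Subgroup.map (MulAut.conj g).toMonoidHom H

lemma conjSubgroup_mono (g : G) {H K : Subgroup G} (h : H ≤ K) :
    conjSubgroup g H ≤ conjSubgroup g K :=
  Subgroup.map_mono h

lemma conjSubgroup_inf (g : G) (H K : Subgroup G) :
    conjSubgroup g (H ⊓ K) = conjSubgroup g H ⊓ conjSubgroup g K :=
  Subgroup.map_inf H K _ (MulAut.conj g).injective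

lemma conjSubgroup_mul (g h : G) (H : Subgroup G) :
    conjSubgroup (g * h) H = conjSubgroup g (conjSubgroup h H) := by
  rw [conjSubgroup, conjSubgroup, conjSubgroup, Subgroup.map_map, map_mul]
  rfl

lemma conjSubgroup_one (H : Subgroup G) : conjSubgroup 1 H = H := by
  rw [conjSubgroup, map_one]
  exact Subgroup.map_id H

lemma card_conjSubgroup (g : G) (H : Subgroup G) :
    Nat.card (conjSubgroup g H) = Nat.card H :=
  Subgroup.card_map_of_injective (MulAut.conj g).injective

/-- `p` is a restriction of a conjugate of `q`. -/
def IsConjRestriction (p q : Subgroup G × Subgroup G) : Prop :=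
  ∃ g : G, p.2 ≤ conjSubgroup g q.2 ∧ p.1 = conjSubgroup g q.1 ⊓ p.2

lemma IsConjRestriction.trans {p q r : Subgroup G × Subgroup G}
    (hpq : IsConjRestriction p q) (hqr : IsConjRestriction q r) : IsConjRestriction p r := by
  obtain ⟨g, hg, hg'⟩ := hpq
  obtain ⟨h, hh, hh'⟩ := hqr
  refine ⟨g * h, ?_, ?_⟩
  · rw [conjSubgroup_mul]
    exact hg.trans (conjSubgroup_mono g hh)
  · rw [hg', hh', conjSubgroup_inf, conjSubgroup_mul, inf_assoc, inf_eq_right.2 hg]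

lemma IsConjRestriction.refl {p : Subgroup G × Subgroup G} (h : p.1 ≤ p.2) :
    IsConjRestriction p p :=
  ⟨1, by rw [conjSubgroup_one], by rw [conjSubgroup_one, inf_eq_left.2 h]⟩

lemma isConjRestriction_conj {H K : Subgroup G} (h : H ≤ K) (g : G) :
    IsConjRestriction (conjSubgroup g H, conjSubgroup g K) (H, K) :=
  ⟨g, le_rfl, (inf_eq_left.2 (conjSubgroup_mono g h)).symm⟩

lemma isConjRestriction_restrict {H K L : Subgroup G} (h : L ≤ K) :
    IsConjRestriction (H ⊓ L, L) (H, K) :=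
  ⟨1, by rwa [conjSubgroup_one], by rw [conjSubgroup_one]⟩

lemma IsConjRestriction.fst_le {p q : Subgroup G × Subgroup G} (h : IsConjRestriction p q) :
    p.1 ≤ p.2 := by
  obtain ⟨g, -, hg⟩ := h
  rw [hg]
  exact inf_le_right

lemma IsConjRestriction.card_fst_le [Finite G] {p q : Subgroup G × Subgroup G}
    (h : IsConjRestriction p q) : Nat.card p.1 ≤ Nat.card q.1 := by
  obtain ⟨g, -, hg⟩ := h
  rw [← card_conjSubgroup g q.1]
  exact Subgroup.card_le_of_le (hg.trans_le inf_le_left)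

lemma mem_of_isConjRestriction {T : Set (Subgroup G × Subgroup G)} (hT : IsTransferSystem T)
    {p q : Subgroup G × Subgroup G} (hq : q ∈ T) (h : IsConjRestriction p q) : p ∈ T := by
  obtain ⟨g, hg, hg'⟩ := h
  have := hT.2.2.2.2 _ _ _ (hT.2.2.2.1 q.1 q.2 hq g) hg
  rwa [← hg'] at this

/-- One step in the transfer system generated by `S`. -/
def Step (S : Set (Subgroup G × Subgroup G)) (H K : Subgroup G) : Prop :=
  ∃ q ∈ S, IsConjRestriction (H, K) q

open Relation

lemma Step.le {S : Set (Subgroup G × Subgroup G)} {H K : Subgroup G} (h : Step S H K) : H ≤ K := by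
  obtain ⟨q, -, h⟩ := h
  exact h.fst_le

lemma le_of_chain {S : Set (Subgroup G × Subgroup G)} {H K : Subgroup G}
    (h : ReflTransGen (Step S) H K) : H ≤ K := by
  induction h with
  | refl => exact le_rfl
  | tail _ h ih => exact ih.trans h.le

lemma isTransferSystem_chain (S : Set (Subgroup G × Subgroup G)) :
    IsTransferSystem {p | ReflTransGen (Step S) p.1 p.2} := by
  refine ⟨fun p hp => le_of_chain hp, fun H => .refl, fun H K L h h' => h.trans h',
    fun H K h g => ?_, fun H K L h hL => ?_⟩
  · refine ReflTransGen.lift (conjSubgroup g) ?_ _ _ h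
    rintro A B ⟨q, hq, hAB⟩
    exact ⟨q, hq, (isConjRestriction_conj hAB.fst_le g).trans hAB⟩
  · have key : ReflTransGen (Step S) (H ⊓ L) (K ⊓ L) := by
      refine ReflTransGen.lift (· ⊓ L) ?_ _ _ h
      rintro A B ⟨q, hq, hAB⟩
      refine ⟨q, hq, IsConjRestriction.trans ?_ hAB⟩
      have := isConjRestriction_restrict (H := A) (inf_le_left : B ⊓ L ≤ B)
      rwa [← inf_assoc, inf_eq_left.2 hAB.fst_le] at this
    rwa [inf_eq_right.2 hL] at key

lemma subset_genTS (S : Set (Subgroup G × Subgroup G)) : S ⊆ genTS S :=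
  Set.subset_sInter fun _ h => h.2

lemma genTS_subset {S T : Set (Subgroup G × Subgroup G)} (hT : IsTransferSystem T) (h : S ⊆ T) :
    genTS S ⊆ T :=
  Set.sInter_subset_of_mem ⟨hT, h⟩

lemma mem_of_chain {S T : Set (Subgroup G × Subgroup G)} (hT : IsTransferSystem T) (hS : S ⊆ T)
    {H K : Subgroup G} (h : ReflTransGen (Step S) H K) : (H, K) ∈ T := by
  induction h with
  | refl => exact hT.2.1 _
  | tail _ h ih =>
    obtain ⟨q, hq, h⟩ := h
    exact hT.2.2.1 _ _ _ ih (mem_of_isConjRestriction hT (hS hq) h)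

lemma chain_of_mem_genTS {S : Set (Subgroup G × Subgroup G)} (hS : ∀ p ∈ S, p.1 ≤ p.2)
    {p : Subgroup G × Subgroup G} (h : p ∈ genTS S) : ReflTransGen (Step S) p.1 p.2 :=
  genTS_subset (isTransferSystem_chain S)
    (fun q hq => .single ⟨q, hq, IsConjRestriction.refl (hS q hq)⟩) h

/-- Generators with a smaller first entry cannot occur in a chain. -/
lemma chain_restrict_generators [Finite G] {S : Set (Subgroup G × Subgroup G)} {H K : Subgroup G}
    (h : ReflTransGen (Step S) H K) :
    ReflTransGen (Step {q ∈ S | Nat.card H ≤ Nat.card q.1}) H K := by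
  induction h with
  | refl => exact .refl
  | tail hc h ih =>
    obtain ⟨q, hq, h⟩ := h
    exact ih.tail ⟨q, ⟨hq, (Subgroup.card_le_of_le (le_of_chain hc)).trans h.card_fst_le⟩, h⟩

/-- A nontrivial pair of `T` that is not a composite of two nontrivial pairs of `T`. -/
def Indecomposable (T : Set (Subgroup G × Subgroup G)) (p : Subgroup G × Subgroup G) : Prop :=
  p ∈ T ∧ p.1 < p.2 ∧ ∀ N, p.1 ≤ N → N ≤ p.2 → (N, p.2) ∈ T → N = p.1 ∨ N = p.2

lemma Indecomposable.step_of_chain {S T : Set (Subgroup G × Subgroup G)} (hT : IsTransferSystem T)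
    (hS : S ⊆ T) {p : Subgroup G × Subgroup G} (hp : Indecomposable T p)
    (h : ReflTransGen (Step S) p.1 p.2) : Step S p.1 p.2 := by
  obtain ⟨H, K⟩ := p
  change ReflTransGen (Step S) H K at h
  induction h using ReflTransGen.head_induction_on with
  | refl => exact absurd hp.2.1 (lt_irrefl _)
  | head h hc ih =>
    rcases hp.2.2 _ h.le (le_of_chain hc) (mem_of_chain hT hS hc) with e | e
    · change _ = _ at e
      subst e
      exact ih hp
    · change _ = _ at e
      subst e
      exact h

/-- `M` is a least intermediate group through which the pair `p` of `T` factors. -/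
def IsFirstFactor (T : Set (Subgroup G × Subgroup G)) (p : Subgroup G × Subgroup G)
    (M : Subgroup G) : Prop :=
  Indecomposable T (p.1, M) ∧ M ≤ p.2 ∧ (M, p.2) ∈ T

lemma exists_isFirstFactor [Finite G] {T : Set (Subgroup G × Subgroup G)}
    (hT : IsTransferSystem T) {p : Subgroup G × Subgroup G} (hp : p ∈ T) (hlt : p.1 < p.2) :
    ∃ M, IsFirstFactor T p M := by
  obtain ⟨M, hM⟩ := (Set.toFinite {M | p.1 < M ∧ M ≤ p.2 ∧ (M, p.2) ∈ T}).exists_minimal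
    ⟨p.2, hlt, le_rfl, hT.2.1 _⟩
  obtain ⟨h1, h2, h3⟩ := hM.prop
  refine ⟨M, ⟨?_, h1, fun N hN hN' hNM => ?_⟩, h2, h3⟩
  · have := hT.2.2.2.2 _ _ _ hp h2
    rwa [inf_eq_left.2 h1.le] at this
  · rcases hN.eq_or_lt with e | hlt'
    · exact .inl e.symm
    · exact .inr (le_antisymm hN'
        (hM.le_of_le ⟨hlt', hN'.trans h2, hT.2.2.1 _ _ _ hNM h3⟩ hN'))

lemma Indecomposable.exists_isConjRestriction [Finite G] {S T : Set (Subgroup G × Subgroup G)}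
    (hT : IsTransferSystem T) (hS : ∀ p ∈ S, p.1 < p.2) (hgen : genTS S = T)
    (r : Subgroup G × Subgroup G → Subgroup G) (hr : ∀ p ∈ S, IsFirstFactor T p (r p))
    {p : Subgroup G × Subgroup G} (hp : Indecomposable T p) :
    ∃ t ∈ S, IsConjRestriction p (t.1, r t) := by
  have hST : S ⊆ T := hgen ▸ subset_genTS S
  have hchain {q} (hq : q ∈ T) : ReflTransGen (Step S) q.1 q.2 :=
    chain_of_mem_genTS (fun p hp => (hS p hp).le) (hgen.symm ▸ hq)
  obtain ⟨t₀, ht₀, hpt₀⟩ := hp.step_of_chain hT hST (hchain hp.1)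
  obtain ⟨t, ⟨ht, hpt⟩, hmax⟩ := Set.exists_max_image {t ∈ S | IsConjRestriction p t}
    (fun t => Nat.card t.1) (Set.toFinite _) ⟨t₀, ht₀, hpt₀⟩
  obtain ⟨hind, hle, hfac⟩ := hr t ht
  obtain ⟨g, hg, hg'⟩ := hpt
  refine ⟨t, ht, ?_⟩
  have hres : IsConjRestriction (conjSubgroup g (r t) ⊓ p.2, p.2) (r t, t.2) := ⟨g, hg, rfl⟩
  rcases hp.2.2 _ (hg'.trans_le (inf_le_inf_right _ (conjSubgroup_mono g hind.2.1.le)))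
    inf_le_right (mem_of_isConjRestriction hT hfac hres) with e | e
  · exfalso
    rw [e] at hres
    obtain ⟨t', ⟨ht', hcard⟩, hpt'⟩ := hp.step_of_chain hT ((Set.sep_subset _ _).trans hST)
      (mem_of_isConjRestriction (isTransferSystem_chain _)
        (chain_restrict_generators (hchain hfac)) hres)
    have hlt : Nat.card t.1 < Nat.card (r t) :=
      Set.ncard_lt_ncard (SetLike.coe_ssubset_coe.2 hind.2.1) (Set.toFinite _)
    exact absurd (hmax t' ⟨ht', hpt'⟩) (not_le.2 (hlt.trans_le hcard))
  · exact ⟨g, inf_eq_right.1 e, hg'⟩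

lemma eq_of_isConjRestriction_of_minimal [Finite G] {S T : Set (Subgroup G × Subgroup G)}
    (hT : IsTransferSystem T) (hS : ∀ p ∈ S, p.1 < p.2) (hgen : genTS S = T)
    (hmin : ∀ S' ⊂ S, genTS S' ≠ T) {s s' : Subgroup G × Subgroup G} {M M' : Subgroup G}
    (hs : s ∈ S) (hs' : s' ∈ S) (hM : IsFirstFactor T s M) (hM' : IsFirstFactor T s' M')
    (h : IsConjRestriction (s.1, M) (s'.1, M')) : s = s' := by
  by_contra hne
  have hST : S ⊆ T := hgen ▸ subset_genTS S
  have hs'M' : IsConjRestriction (s'.1, M') s' := by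
    have := isConjRestriction_restrict (H := s'.1) hM'.2.1
    rwa [inf_eq_left.2 hM'.1.2.1.le] at this
  have hlow : ReflTransGen (Step (S \ {s})) s.1 M :=
    .single ⟨s', ⟨hs', Ne.symm hne⟩, h.trans hs'M'⟩
  have hlt : Nat.card s.1 < Nat.card M :=
    Set.ncard_lt_ncard (SetLike.coe_ssubset_coe.2 hM.1.2.1) (Set.toFinite _)
  have hhigh : ReflTransGen (Step (S \ {s})) M s.2 := by
    refine ReflTransGen.mono ?_ _ _ (chain_restrict_generators
      (chain_of_mem_genTS (fun p hp => (hS p hp).le) (hgen.symm ▸ hM.2.2)))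
    rintro A B ⟨q, ⟨hq, hcard⟩, hAB⟩
    refine ⟨q, ⟨hq, ?_⟩, hAB⟩
    rintro rfl
    exact absurd hcard (not_le.2 hlt)
  refine hmin (S \ {s}) (Set.sdiff_singleton_ssubset.2 hs) ?_
  refine (genTS_subset hT (Set.sdiff_subset.trans hST)).antisymm ?_
  refine Set.subset_sInter fun U hU => ?_
  rw [← hgen]
  refine genTS_subset hU.1 fun q hq => ?_
  by_cases hqs : q = s
  · subst hqs
    exact mem_of_chain hU.1 hU.2 (hlow.trans hhigh)
  · exact hU.2 ⟨hq, hqs⟩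

lemma ncard_le_of_minimal [Finite G] {T S₁ S₂ : Set (Subgroup G × Subgroup G)}
    (hT : IsTransferSystem T)
    (h₁lt : ∀ p ∈ S₁, p.1 < p.2) (h₁gen : genTS S₁ = T) (h₁min : ∀ S' ⊂ S₁, genTS S' ≠ T)
    (h₂lt : ∀ p ∈ S₂, p.1 < p.2) (h₂gen : genTS S₂ = T) : S₁.ncard ≤ S₂.ncard := by
  have hfac : ∀ p : Subgroup G × Subgroup G, ∃ M, p ∈ T → p.1 < p.2 → IsFirstFactor T p M := by
    intro p
    by_cases h : p ∈ T ∧ p.1 < p.2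
    · obtain ⟨M, hM⟩ := exists_isFirstFactor hT h.1 h.2
      exact ⟨M, fun _ _ => hM⟩
    · exact ⟨⊥, fun h₁ h₂ => absurd ⟨h₁, h₂⟩ h⟩
  choose r hr using hfac
  have hr₁ : ∀ p ∈ S₁, IsFirstFactor T p (r p) :=
    fun p hp => hr p (h₁gen ▸ subset_genTS S₁ hp) (h₁lt p hp)
  have hr₂ : ∀ p ∈ S₂, IsFirstFactor T p (r p) :=
    fun p hp => hr p (h₂gen ▸ subset_genTS S₂ hp) (h₂lt p hp)
  have hex : ∀ s ∈ S₁, ∃ t ∈ S₂, IsConjRestriction (s.1, r s) (t.1, r t) := fun s hs =>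
    (hr₁ s hs).1.exists_isConjRestriction hT h₂lt h₂gen r hr₂
  choose! f hf hf' using hex
  refine Set.ncard_le_ncard_of_injOn f hf ?_ (Set.toFinite _)
  intro s hs s' hs' hss'
  obtain ⟨u, hu, hfu⟩ :=
    (hr₂ _ (hf s hs)).1.exists_isConjRestriction hT h₁lt h₁gen r hr₁
  have eq_u {v} (hv : v ∈ S₁) (hvf : f v = f s) : v = u :=
    eq_of_isConjRestriction_of_minimal hT h₁lt h₁gen h₁min hv hu (hr₁ v hv) (hr₁ u hu)
      ((hvf ▸ hf' v hv).trans hfu)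
  exact (eq_u hs rfl).trans (eq_u hs' hss'.symm).symm

end TransferSystem

/-- Any two inclusion-minimal generating sets of a transfer system `T`, consisting of
pairs `(H, K)` with `H < K`, have the same cardinality. -/
theorem minimal_generating_sets_same_card
    {G : Type*} [Group G] [Finite G] (T : Set (Subgroup G × Subgroup G))
    (hT : IsTransferSystem T)
    (S₁ S₂ : Set (Subgroup G × Subgroup G))
    (h₁lt : ∀ p ∈ S₁, p.1 < p.2) (h₁gen : genTS S₁ = T)
    (h₁min : ∀ S' ⊂ S₁, genTS S' ≠ T)
    (h₂lt : ∀ p ∈ S₂, p.1 < p.2) (h₂gen : genTS S₂ = T)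
    (h₂min : ∀ S' ⊂ S₂, genTS S' ≠ T) :
    S₁.ncard = S₂.ncard := by
  exact le_antisymm
    (TransferSystem.ncard_le_of_minimal hT h₁lt h₁gen h₁min h₂lt h₂gen)
    (TransferSystem.ncard_le_of_minimal hT h₂lt h₂gen h₂min h₁lt h₁gen)
end
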